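/- Let n ≥ 3 and 0 ≤ k_2 ≤ n−3 be integers. Then the polynomial x_{n−1} x_{k_2} − ((n−1)/(k_2+1))·x_{n−2} x_{k_2+1} belongs to S_{n,2}. -/

import Mathlib

open MvPolynomial

/-- The jet inversion: given the jets `a j = x^{(j)}(t₀)` of a function `x` with
`x(t₀) ≠ 0`, `iota a j = (1/x)^{(j)}(t₀)`, defined by `iota a 0 = 1 / a 0` and the
recursion `∑_{j=0}^{k} (k.choose j) * a j * iota a (k - j) = 0` for `k ≥ 1`. -/
noncomputable def iota (a : ℕ → ℂ) : ℕ → ℂ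
  | 0 => 1 / a 0
  | (k+1) => -(1 / a 0) * ∑ j ∈ Finset.range (k+1),
      ((k+1).choose (j+1) : ℂ) * a (j+1) * iota a (k - j)
  termination_by k => k
  decreasing_by exact Nat.lt_succ_of_le (Nat.sub_le k j)

/-- `JetRel n ρ₁ ρ₂` means `ρ₁ ∼ₙ ρ₂`:  `ρ₁(a) = a₀ⁿ ρ₂(ιₙ(a))` whenever `a₀ ≠ 0`. -/
def JetRel (n : ℕ) (ρ₁ ρ₂ : MvPolynomial ℕ ℂ) : Prop :=
  ∀ a : ℕ → ℂ, a 0 ≠ 0 → eval a ρ₁ = (a 0) ^ n * eval (iota a) ρ₂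

/-- The space `Sₙ` of polynomials `ρ₁ ∈ ℂ[x₀, …, x_{n-1}]` such that `ρ₁ ∼ₙ ρ₂` for some
polynomial `ρ₂ ∈ ℂ[x₀, …, x_{n-1}]`. -/
noncomputable def Sn (n : ℕ) : Submodule ℂ (MvPolynomial ℕ ℂ) where
  carrier := {ρ₁ | ρ₁ ∈ supported ℂ (Set.Iio n) ∧
    ∃ ρ₂ ∈ supported ℂ (Set.Iio n), JetRel n ρ₁ ρ₂}
  add_mem' := by
    rintro p q ⟨hp, p₂, hp₂, hrp⟩ ⟨hq, q₂, hq₂, hrq⟩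
    refine ⟨add_mem hp hq, p₂ + q₂, add_mem hp₂ hq₂, fun a ha => ?_⟩
    simp only [map_add, hrp a ha, hrq a ha, mul_add]
  zero_mem' := ⟨zero_mem _, 0, zero_mem _, fun a ha => by simp⟩
  smul_mem' := by
    rintro c p ⟨hp, p₂, hp₂, hrp⟩
    refine ⟨Subalgebra.smul_mem _ hp c, c • p₂, Subalgebra.smul_mem _ hp₂ c, fun a ha => ?_⟩
    simp only [MvPolynomial.smul_eq_C_mul, map_mul, eval_C, hrp a ha]
    ring

/-- `S_{n,d}`: the homogeneous degree-`d` part of `Sₙ`. -/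
noncomputable def Snd (n d : ℕ) : Submodule ℂ (MvPolynomial ℕ ℂ) :=
  Sn n ⊓ homogeneousSubmodule ℕ ℂ d

/-- `S_{n,d,l}`: the part of `S_{n,d}` of weighted degree `l`, where variable `xᵢ`
has weight `i`. -/
noncomputable def Sndl (n d l : ℕ) : Submodule ℂ (MvPolynomial ℕ ℂ) :=
  Snd n d ⊓ weightedHomogeneousSubmodule ℂ (fun i : ℕ => i) l

/-- The Taylor coefficient `a k / k!` attached to a jet `a`. -/
noncomputable def taylorCoeff (a : ℕ → ℂ) (k : ℕ) : ℂ := a k / (k.factorial : ℂ)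

/-- The Taylor coefficients shifted by one place, starting with `0`. -/
noncomputable def shiftedCoeff (a : ℕ → ℂ) : ℕ → ℂ
  | 0 => 0
  | k + 1 => taylorCoeff a k

theorem shiftedCoeff_zero (a : ℕ → ℂ) : shiftedCoeff a 0 = 0 := rfl

theorem shiftedCoeff_succ (a : ℕ → ℂ) (k : ℕ) : shiftedCoeff a (k + 1) = taylorCoeff a k := rfl

/-- The `2 × 2` Toeplitz minor of the Taylor coefficients with columns `p` and `q`. -/
noncomputable def toeplitzMinor (p q : ℕ) (a : ℕ → ℂ) : ℂ :=
  shiftedCoeff a p * taylorCoeff a q - taylorCoeff a p * shiftedCoeff a q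

theorem iota_zero (a : ℕ → ℂ) : iota a 0 = 1 / a 0 := by
  rw [iota]

theorem mul_iota_succ (a : ℕ → ℂ) (ha : a 0 ≠ 0) (k : ℕ) :
    a 0 * iota a (k + 1) = -∑ j ∈ Finset.range (k + 1),
      ((k + 1).choose (j + 1) : ℂ) * a (j + 1) * iota a (k - j) := by
  rw [iota]
  field_simp

theorem sum_taylorCoeff_mul_taylorCoeff_iota (a : ℕ → ℂ) (ha : a 0 ≠ 0) (k : ℕ) :
    ∑ j ∈ Finset.range (k + 2), taylorCoeff a j * taylorCoeff (iota a) (k + 1 - j) = 0 := by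
  have hterm : ∀ j ∈ Finset.range (k + 2),
      taylorCoeff a j * taylorCoeff (iota a) (k + 1 - j) =
        (((k + 1).choose j : ℂ) * a j * iota a (k + 1 - j)) / ((k + 1).factorial : ℂ) := by
    intro j hj
    have hjk : j ≤ k + 1 := Nat.lt_succ_iff.mp (Finset.mem_range.mp hj)
    rw [Nat.cast_choose ℂ hjk, taylorCoeff, taylorCoeff]
    have h₁ : (j.factorial : ℂ) ≠ 0 := Nat.cast_ne_zero.mpr j.factorial_ne_zero
    have h₂ : ((k + 1 - j).factorial : ℂ) ≠ 0 := Nat.cast_ne_zero.mpr (Nat.factorial_ne_zero _)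
    have h₃ : ((k + 1).factorial : ℂ) ≠ 0 := Nat.cast_ne_zero.mpr (Nat.factorial_ne_zero _)
    field_simp
  rw [Finset.sum_congr rfl hterm, ← Finset.sum_div, Finset.sum_range_succ']
  simp [mul_iota_succ a ha k]

theorem taylorCoeff_succ (a : ℕ → ℂ) (ha : a 0 ≠ 0) (k : ℕ) :
    taylorCoeff a (k + 1) = -a 0 * ∑ i ∈ Finset.range (k + 1),
      taylorCoeff (iota a) (i + 1) * taylorCoeff a (k - i) := by
  have h := sum_taylorCoeff_mul_taylorCoeff_iota a ha k
  rw [← Finset.sum_range_reflect, Finset.sum_range_succ'] at h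
  have hterm : ∀ i ∈ Finset.range (k + 1),
      taylorCoeff a (k + 2 - 1 - (i + 1)) *
        taylorCoeff (iota a) (k + 1 - (k + 2 - 1 - (i + 1))) =
      taylorCoeff (iota a) (i + 1) * taylorCoeff a (k - i) := by
    intro i hi
    have hik := Finset.mem_range.mp hi
    rw [show k + 2 - 1 - (i + 1) = k - i by lia, show k + 1 - (k - i) = i + 1 by lia, mul_comm]
  rw [Finset.sum_congr rfl hterm] at h
  have h₀ : taylorCoeff (iota a) 0 = 1 / a 0 := by simp [taylorCoeff, iota_zero]
  simp only [Nat.sub_zero, show k + 2 - 1 = k + 1 by lia, Nat.sub_self, h₀] at h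
  field_simp at h
  linear_combination h

theorem shiftedCoeff_add_two (a : ℕ → ℂ) (ha : a 0 ≠ 0) (k : ℕ) :
    shiftedCoeff a (k + 2) = -a 0 * ∑ i ∈ Finset.range (k + 2),
      taylorCoeff (iota a) (i + 1) * shiftedCoeff a (k + 1 - i) := by
  rw [Finset.sum_range_succ, shiftedCoeff_succ, taylorCoeff_succ a ha, Nat.sub_self,
    shiftedCoeff_zero, mul_zero, add_zero]
  congr 1
  refine Finset.sum_congr rfl fun i hi => ?_
  have hik := Finset.mem_range.mp hi
  rw [show k + 1 - i = k - i + 1 by lia, shiftedCoeff_succ]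

theorem toeplitzMinor_add_two (a : ℕ → ℂ) (ha : a 0 ≠ 0) (p k : ℕ) :
    toeplitzMinor p (k + 2) a = ∑ i ∈ Finset.range (k + 2),
      a 0 * (-taylorCoeff (iota a) (i + 1) * toeplitzMinor p (k + 1 - i) a) := by
  rw [toeplitzMinor, taylorCoeff_succ a ha (k + 1), shiftedCoeff_add_two a ha]
  simp only [Finset.mul_sum, ← Finset.sum_sub_distrib]
  refine Finset.sum_congr rfl fun i _ => ?_
  rw [toeplitzMinor]
  ring

theorem toeplitzMinor_self (p : ℕ) (a : ℕ → ℂ) : toeplitzMinor p p a = 0 := by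
  rw [toeplitzMinor]
  ring

theorem toeplitzMinor_swap (p q : ℕ) (a : ℕ → ℂ) :
    toeplitzMinor p q a = -toeplitzMinor q p a := by
  rw [toeplitzMinor, toeplitzMinor]
  ring

/-- The functions of jets of the form `a ↦ a₀ⁿ ρ(ιₙ(a))` with `ρ ∈ ℂ[x₀, …, x_{n-1}]`. -/
def IsJetTransform (n : ℕ) (f : (ℕ → ℂ) → ℂ) : Prop :=
  ∃ ρ ∈ supported ℂ (Set.Iio n), ∀ a : ℕ → ℂ, a 0 ≠ 0 → f a = a 0 ^ n * eval (iota a) ρ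

namespace IsJetTransform

theorem congr {n : ℕ} {f g : (ℕ → ℂ) → ℂ} (hf : IsJetTransform n f)
    (h : ∀ a : ℕ → ℂ, a 0 ≠ 0 → g a = f a) : IsJetTransform n g := by
  obtain ⟨ρ, hρ, hfρ⟩ := hf
  exact ⟨ρ, hρ, fun a ha => (h a ha).trans (hfρ a ha)⟩

theorem zero (n : ℕ) : IsJetTransform n fun _ => 0 :=
  ⟨0, zero_mem _, fun a _ => by simp⟩

theorem const_mul {n : ℕ} {f : (ℕ → ℂ) → ℂ} (c : ℂ) (hf : IsJetTransform n f) :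
    IsJetTransform n fun a => c * f a := by
  obtain ⟨ρ, hρ, hfρ⟩ := hf
  refine ⟨c • ρ, Subalgebra.smul_mem _ hρ c, fun a ha => ?_⟩
  simp only [smul_eval, hfρ a ha]
  ring

theorem sum {n : ℕ} {s : Finset ℕ} {f : ℕ → (ℕ → ℂ) → ℂ}
    (hf : ∀ i ∈ s, IsJetTransform n (f i)) : IsJetTransform n fun a => ∑ i ∈ s, f i a := by
  choose! ρ hρ hfρ using hf
  refine ⟨∑ i ∈ s, ρ i, sum_mem hρ, fun a ha => ?_⟩
  rw [map_sum, Finset.mul_sum]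
  exact Finset.sum_congr rfl fun i hi => hfρ i hi a ha

theorem mul_iota {n j : ℕ} {f : (ℕ → ℂ) → ℂ} (hf : IsJetTransform n f) (hj : j ≤ n) :
    IsJetTransform (n + 1) fun a => a 0 * (iota a j * f a) := by
  obtain ⟨ρ, hρ, hfρ⟩ := hf
  refine ⟨X j * ρ, mul_mem (X_mem_supported.mpr (Nat.lt_succ_of_le hj))
    (supported_mono (Set.Iio_subset_Iio n.le_succ) hρ), fun a ha => ?_⟩
  simp only [map_mul, eval_X, hfρ a ha]
  ring

end IsJetTransform

theorem isJetTransform_toeplitzMinor (q : ℕ) :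
    ∀ p r : ℕ, p ≤ q → r ≤ q → IsJetTransform (q + 1) (toeplitzMinor p r) := by
  induction q with
  | zero =>
    intro p r hp hr
    obtain rfl := Nat.le_zero.mp hp
    obtain rfl := Nat.le_zero.mp hr
    exact (IsJetTransform.zero _).congr fun a _ => toeplitzMinor_self 0 a
  | succ q ih =>
    have hlast : ∀ p ≤ q, IsJetTransform (q + 2) (toeplitzMinor p (q + 1)) := by
      intro p hp
      rcases q with _ | q
      · obtain rfl := Nat.le_zero.mp hp
        refine ⟨-1, neg_mem (one_mem _), fun a _ => ?_⟩
        simp [toeplitzMinor, shiftedCoeff, taylorCoeff, sq]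
      · refine IsJetTransform.congr (IsJetTransform.sum (s := Finset.range (q + 2))
          (f := fun i a => a 0 * (-taylorCoeff (iota a) (i + 1) *
            toeplitzMinor p (q + 1 - i) a)) fun i hi => ?_)
          fun a ha => toeplitzMinor_add_two a ha p q
        have hiq := Finset.mem_range.mp hi
        refine (((ih p (q + 1 - i) hp (Nat.sub_le _ _)).mul_iota
          (j := i + 1) (by lia)).const_mul (-1 / ((i + 1).factorial : ℂ))).congr fun a _ => ?_
        rw [taylorCoeff]
        ring
    intro p r hp hr
    rcases hp.lt_or_eq with hp | rfl <;> rcases hr.lt_or_eq with hr | rfl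
    · refine ((ih p r (by lia) (by lia)).mul_iota (Nat.zero_le _)).congr fun a ha => ?_
      rw [iota_zero]
      field_simp
    · exact hlast p (by lia)
    · exact ((hlast r (by lia)).const_mul (-1)).congr fun a _ => by
        rw [toeplitzMinor_swap, neg_one_mul]
    · exact (IsJetTransform.zero _).congr fun a _ => toeplitzMinor_self _ a

/-- Let `n ≥ 3` and `0 ≤ k₂ ≤ n−3`. The polynomial
`x_{n−1} x_{k₂} − ((n−1)/(k₂+1)) x_{n−2} x_{k₂+1}` belongs to `S_{n,2}`. -/
theorem stmt7 (n k₂ : ℕ) (hn : 3 ≤ n) (hk : k₂ ≤ n - 3) :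
    X (n - 1) * X k₂ - C (((n : ℂ) - 1) / ((k₂ : ℂ) + 1)) * (X (n - 2) * X (k₂ + 1)) ∈
      Snd n 2 := by
  obtain ⟨m, rfl⟩ : ∃ m, n = m + 2 := ⟨n - 2, by lia⟩
  have hkm : k₂ + 1 ≤ m := by lia
  simp only [show m + 2 - 1 = m + 1 by lia, Nat.add_sub_cancel]
  have hX : ∀ j < m + 2, (X j : MvPolynomial ℕ ℂ) ∈ supported ℂ (Set.Iio (m + 2)) :=
    fun j hj => X_mem_supported.mpr hj
  refine Submodule.mem_inf.mpr ⟨⟨?_, ?_⟩, ?_⟩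
  · exact sub_mem (mul_mem (hX _ (by lia)) (hX _ (by lia)))
      (mul_mem (Subalgebra.algebraMap_mem _ _) (mul_mem (hX _ (by lia)) (hX _ (by lia))))
  · refine ((isJetTransform_toeplitzMinor (m + 1) (k₂ + 1) (m + 1) (by lia) le_rfl).const_mul
      (((m + 1).factorial : ℂ) * (k₂.factorial : ℂ))).congr fun a _ => ?_
    have hm₀ : (m.factorial : ℂ) ≠ 0 := Nat.cast_ne_zero.mpr m.factorial_ne_zero
    have hk₀ : (k₂.factorial : ℂ) ≠ 0 := Nat.cast_ne_zero.mpr k₂.factorial_ne_zero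
    have hm₁ : (m : ℂ) + 1 ≠ 0 := Nat.cast_add_one_ne_zero m
    have hk₁ : (k₂ : ℂ) + 1 ≠ 0 := Nat.cast_add_one_ne_zero k₂
    simp only [map_sub, map_mul, eval_X, eval_C, toeplitzMinor, shiftedCoeff, taylorCoeff,
      Nat.factorial_succ]
    push_cast
    field_simp
    ring
  · have hquad : ∀ i j : ℕ, (X i * X j : MvPolynomial ℕ ℂ).IsHomogeneous 2 :=
      fun i j => (isHomogeneous_X ℂ i).mul (isHomogeneous_X ℂ j)
    exact sub_mem (hquad _ _) ((hquad _ _).C_mul _)
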